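/- arXiv:0807.3212 — 4 statements merged into one kernel-verified Lean document; each statement's English description precedes it below -/
import Mathlib

section
/- There exist 304 three-dimensional subspaces of GF(2)^7 such that any two distinct ones intersect in a subspace of dimension at most 1; equivalently, there is a constant dimension code in GF(2)^7 of dimension 3 with 304 codewords and minimum subspace distance at least 4, so A_2(7,4,3) ≥ 304. -/
open Module

/-- The subspace distance `d_S(V,W) := dim(V+W) − dim(V∩W)`. -/
noncomputable def subspaceDist (F : Type*) [Field F] {M : Type*} [AddCommGroup M]
    [Module F M] (V W : Submodule F M) : ℕ :=
  finrank F ↥(V ⊔ W) - finrank F ↥(V ⊓ W)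

namespace GFCode

/-- The vector of `GF(2)^7` whose coordinates are the binary digits of `n`. -/
def vec (n : ℕ) : Fin 7 → ZMod 2 := fun i => if n.testBit i then 1 else 0

/-- Inverse of `vec` on numbers below 128. -/
def dec (v : Fin 7 → ZMod 2) : ℕ := ∑ i : Fin 7, if v i = 1 then 2 ^ (i : ℕ) else 0

theorem vec_xor (a b : ℕ) : vec (a ^^^ b) = vec a + vec b := by
  funext i
  simp only [vec, Nat.testBit_xor, Pi.add_apply]
  cases a.testBit i <;> cases b.testBit i <;> decide

theorem vec_zero : vec 0 = 0 := by
  funext i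
  simp [vec]

theorem dec_vec : ∀ x < 128, dec (vec x) = x := by decide +kernel

/-- The seven nonzero elements spanned by three numbers under xor. -/
def pts (t : ℕ × ℕ × ℕ) : List ℕ :=
  [t.1, t.2.1, t.1 ^^^ t.2.1, t.2.2, t.1 ^^^ t.2.2, t.2.1 ^^^ t.2.2, t.1 ^^^ t.2.1 ^^^ t.2.2]

/-- Bit mask of a list of numbers. -/
def mask : List ℕ → ℕ
  | [] => 0
  | x :: l => 2 ^ x ||| mask l

theorem testBit_mask {l : List ℕ} {x : ℕ} (h : x ∈ l) : (mask l).testBit x = true := by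
  induction l with
  | nil => simp at h
  | cons y l ih =>
    rcases List.mem_cons.1 h with rfl | h
    · simp [mask]
    · simp [mask, ih h]

/-- The subspace spanned by a triple. -/
def sp (t : ℕ × ℕ × ℕ) : Submodule (ZMod 2) (Fin 7 → ZMod 2) :=
  Submodule.span (ZMod 2) {vec t.1, vec t.2.1, vec t.2.2}

theorem mem_sp (t : ℕ × ℕ × ℕ) (v : Fin 7 → ZMod 2) :
    v ∈ sp t ↔ ∃ x ∈ 0 :: pts t, vec x = v := by
  obtain ⟨a, b, c⟩ := t
  constructor
  · intro h
    obtain ⟨r, s, u, rfl⟩ := Submodule.mem_span_triple.1 h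
    have key : ∀ z : ZMod 2, z = 0 ∨ z = 1 := by decide
    simp only [pts]
    rcases key r with rfl | rfl <;> rcases key s with rfl | rfl <;>
      rcases key u with rfl | rfl <;> simp [vec_zero, vec_xor]
  · rintro ⟨x, hx, rfl⟩
    have ha : vec a ∈ sp (a, b, c) := Submodule.subset_span (by simp)
    have hb : vec b ∈ sp (a, b, c) := Submodule.subset_span (by simp)
    have hc : vec c ∈ sp (a, b, c) := Submodule.subset_span (by simp)
    simp only [pts, List.mem_cons, List.not_mem_nil, or_false] at hx
    rcases hx with rfl | rfl | rfl | rfl | rfl | rfl | rfl | rfl <;>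
      (try simp only [vec_zero, vec_xor]) <;>
      first
        | exact Submodule.zero_mem _
        | assumption
        | exact Submodule.add_mem _ ‹_› ‹_›
        | exact Submodule.add_mem _ (Submodule.add_mem _ ha hb) hc

/-- A triple is good if it consists of independent vectors of `GF(2)^7`. -/
def good (t : ℕ × ℕ × ℕ) : Prop := (∀ x ∈ 0 :: pts t, x < 128) ∧ (0 :: pts t).Nodup

instance (t : ℕ × ℕ × ℕ) : Decidable (good t) := by unfold good; infer_instance

theorem card_eq (V : Submodule (ZMod 2) (Fin 7 → ZMod 2)) :
    (V : Set (Fin 7 → ZMod 2)).ncard = 2 ^ finrank (ZMod 2) V := by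
  have h := Module.natCard_eq_pow_finrank (K := ZMod 2) (V := V)
  rw [Nat.card_zmod] at h
  rw [← h]
  exact (Nat.card_coe_set_eq _).symm

theorem finrank_sp {t : ℕ × ℕ × ℕ} (h : good t) : finrank (ZMod 2) (sp t) = 3 := by
  have hs : (sp t : Set (Fin 7 → ZMod 2)) = vec '' ((0 :: pts t).toFinset : Set ℕ) := by
    ext v
    simp only [SetLike.mem_coe, mem_sp, Set.mem_image, List.mem_toFinset]
  have hc : (sp t : Set (Fin 7 → ZMod 2)).ncard = 8 := by
    rw [hs, Set.InjOn.ncard_image, Set.ncard_coe_finset, List.toFinset_card_of_nodup h.2]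
    · rfl
    · intro x hx y hy hxy
      rw [← dec_vec x (h.1 x (by simpa using hx)), hxy, dec_vec y (h.1 y (by simpa using hy))]
  rw [card_eq] at hc
  exact Nat.pow_right_injective (le_refl 2) (by simpa using hc)

/-- Two masks have at most one common bit: the conjunction is zero or divides `2 ^ 127`. -/
def ok (m n : ℕ) : Bool :=
  Nat.beq (Nat.land m n) 0 || Nat.beq (Nat.mod (2 ^ 127) (Nat.land m n)) 0

theorem ok_spec {m n x y : ℕ} (h : ok m n = true) (hx : m.testBit x = true)
    (hx' : n.testBit x = true) (hy : m.testBit y = true) (hy' : n.testBit y = true) : x = y := by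
  have h1 : (m &&& n).testBit x = true := by simp [hx, hx']
  have h2 : (m &&& n).testBit y = true := by simp [hy, hy']
  have h3 : (m &&& n) = 0 ∨ 2 ^ 127 % (m &&& n) = 0 := by
    unfold ok at h
    rcases Bool.or_eq_true_iff.1 h with h | h
    · exact Or.inl (Nat.eq_of_beq_eq_true h)
    · exact Or.inr (Nat.eq_of_beq_eq_true h)
  generalize m &&& n = k at *
  rcases h3 with rfl | h3
  · simp at h1
  · obtain ⟨j, -, rfl⟩ := (Nat.dvd_prime_pow Nat.prime_two).1 (Nat.dvd_of_mod_eq_zero h3)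
    rw [Nat.testBit_two_pow] at h1 h2
    simp at h1 h2
    omega

theorem finrank_inf_le {s t : ℕ × ℕ × ℕ} (hs : good s) (ht : good t)
    (h : ok (mask (pts s)) (mask (pts t)) = true) :
    finrank (ZMod 2) ↥(sp s ⊓ sp t) ≤ 1 := by
  have key : ∀ v ∈ sp s ⊓ sp t, v ≠ 0 →
      ∃ x, vec x = v ∧ x ∈ pts s ∧ x ∈ pts t := by
    rintro v ⟨h1, h2⟩ hv
    obtain ⟨x, hx, rfl⟩ := (mem_sp _ _).1 h1
    obtain ⟨y, hy, hxy⟩ := (mem_sp _ _).1 h2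
    have : y = x := by
      rw [← dec_vec x (hs.1 x hx), ← hxy, dec_vec y (ht.1 y hy)]
    subst this
    have h0 : y ≠ 0 := by
      rintro rfl
      exact hv vec_zero
    exact ⟨y, rfl, (List.mem_cons.1 hx).resolve_left h0, (List.mem_cons.1 hy).resolve_left h0⟩
  by_contra hlt
  have hc : 2 < ((sp s ⊓ sp t : Submodule (ZMod 2) (Fin 7 → ZMod 2)) :
      Set (Fin 7 → ZMod 2)).ncard := by
    rw [card_eq]
    calc 2 < 2 ^ 2 := by norm_num
      _ ≤ _ := Nat.pow_le_pow_right (by norm_num) (by omega)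
  obtain ⟨u, hu, hu0, w, hw, hw0, huw⟩ : ∃ u ∈ sp s ⊓ sp t, u ≠ 0 ∧
      ∃ w ∈ sp s ⊓ sp t, w ≠ 0 ∧ u ≠ w := by
    obtain ⟨a, b, c, ha, hb, hc, hab, hac, hbc⟩ := (Set.two_lt_ncard_iff (Set.toFinite _)).1 hc
    by_cases h1 : a = 0
    · exact ⟨b, hb, fun h => hab (h1.trans h.symm), c, hc, fun h => hac (h1.trans h.symm), hbc⟩
    · by_cases h2 : b = 0
      · exact ⟨a, ha, h1, c, hc, fun h => hbc (h2.trans h.symm), hac⟩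
      · exact ⟨a, ha, h1, b, hb, h2, hab⟩
  obtain ⟨x, rfl, hx1, hx2⟩ := key u hu hu0
  obtain ⟨y, rfl, hy1, hy2⟩ := key w hw hw0
  exact huw (congrArg vec (ok_spec h (testBit_mask hx1) (testBit_mask hx2)
    (testBit_mask hy1) (testBit_mask hy2)))

/-- Pairwise check on a list of masks. -/
def chk : List ℕ → Bool
  | [] => true
  | m :: l => l.all (ok m) && chk l

theorem chk_spec {l : List ℕ} (h : chk l = true) : l.Pairwise (fun m n => ok m n = true) := by
  induction l with
  | nil => exact List.Pairwise.nil
  | cons m l ih =>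
    simp only [chk, Bool.and_eq_true, List.all_eq_true] at h
    exact List.Pairwise.cons h.1 (ih h.2)

/-- Bases of the 304 codewords, found by a search among the codes that are invariant under a
group of order 21. -/
def code : List (ℕ × ℕ × ℕ) := [
  (48, 4, 1), (65, 52, 2), (72, 60, 1), (67, 10, 5), (65, 50, 7), (53, 9, 3),
  (50, 11, 4), (76, 61, 2), (72, 4, 3), (9, 5, 2), (65, 48, 9), (75, 57, 5),
  (64, 14, 1), (67, 48, 12), (116, 12, 3), (114, 10, 1), (64, 49, 3), (64, 52, 11),
  (113, 10, 4), (73, 48, 2), (70, 49, 14), (26, 6, 1), (67, 38, 9), (77, 46, 23),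
  (68, 19, 10), (79, 40, 26), (83, 51, 12), (82, 42, 4), (105, 25, 2), (64, 39, 8),
  (90, 32, 5), (65, 41, 19), (69, 44, 16), (81, 49, 15), (71, 37, 17), (104, 29, 3),
  (66, 39, 11), (70, 32, 23), (75, 41, 28), (38, 16, 14), (83, 48, 13), (76, 42, 17),
  (84, 8, 1), (67, 35, 26), (78, 34, 24), (69, 36, 10), (39, 21, 12), (71, 32, 31),
  (91, 41, 4), (64, 16, 2), (72, 33, 22), (106, 17, 5), (65, 37, 29), (84, 49, 13),
  (35, 23, 15), (81, 34, 6), (73, 40, 3), (70, 21, 11), (68, 42, 31), (75, 45, 27),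
  (33, 18, 14), (76, 38, 22), (99, 19, 7), (34, 12, 1), (67, 34, 25), (97, 19, 6),
  (64, 21, 10), (77, 45, 31), (68, 45, 18), (107, 18, 4), (37, 20, 2), (72, 32, 20),
  (89, 41, 5), (65, 16, 8), (70, 36, 24), (36, 17, 15), (69, 43, 29), (88, 61, 3),
  (71, 23, 11), (80, 33, 7), (66, 33, 9), (83, 55, 14), (78, 42, 26), (79, 35, 27),
  (96, 16, 1), (67, 21, 8), (101, 17, 14), (39, 23, 10), (69, 32, 18), (40, 22, 1),
  (67, 16, 4), (92, 40, 2), (66, 17, 10), (42, 24, 5), (65, 36, 27), (43, 19, 4),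
  (85, 13, 2), (72, 40, 19), (80, 5, 3), (65, 33, 11), (77, 39, 27), (68, 32, 15),
  (84, 39, 14), (32, 16, 3), (85, 34, 11), (36, 18, 1), (67, 43, 22), (76, 44, 20),
  (81, 10, 7), (80, 50, 9), (33, 24, 6), (74, 32, 4), (77, 41, 2), (68, 16, 12),
  (91, 35, 5), (65, 34, 17), (64, 33, 29), (101, 21, 15), (100, 23, 8), (84, 45, 3),
  (35, 18, 11), (69, 34, 22), (75, 42, 20), (71, 21, 14), (70, 47, 31), (66, 45, 24),
  (74, 24, 1), (67, 36, 14), (68, 43, 27), (82, 37, 10), (90, 50, 1), (67, 44, 19),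
  (81, 33, 4), (96, 8, 2), (72, 44, 30), (81, 58, 5), (65, 35, 4), (32, 28, 2),
  (71, 38, 15), (99, 16, 5), (65, 28, 3), (38, 17, 11), (99, 18, 15), (75, 46, 22),
  (20, 13, 3), (87, 48, 11), (89, 40, 6), (98, 30, 1), (67, 45, 30), (102, 18, 8),
  (102, 22, 10), (38, 20, 8), (69, 38, 25), (89, 58, 4), (69, 24, 2), (72, 36, 26),
  (66, 43, 5), (65, 46, 25), (66, 37, 25), (80, 55, 15), (82, 33, 13), (81, 56, 3),
  (98, 11, 6), (74, 37, 30), (75, 35, 6), (68, 34, 14), (77, 44, 28), (68, 38, 21),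
  (88, 38, 1), (67, 32, 24), (80, 36, 13), (33, 16, 10), (88, 50, 6), (74, 46, 17),
  (73, 25, 4), (68, 33, 2), (72, 34, 23), (82, 51, 5), (65, 40, 21), (76, 35, 31),
  (34, 8, 7), (97, 18, 9), (44, 21, 3), (69, 20, 11), (79, 45, 19), (71, 18, 12),
  (96, 22, 14), (66, 36, 20), (64, 43, 28), (80, 42, 1), (67, 33, 27), (69, 47, 30),
  (80, 52, 10), (71, 33, 19), (73, 35, 28), (66, 34, 4), (84, 53, 2), (72, 35, 21),
  (34, 26, 5), (65, 32, 13), (41, 18, 7), (16, 9, 6), (74, 45, 20), (77, 17, 3),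
  (68, 22, 11), (101, 20, 12), (75, 36, 23), (87, 37, 14), (64, 40, 24), (83, 36, 8),
  (70, 44, 1), (67, 39, 18), (66, 32, 22), (35, 20, 10), (76, 34, 16), (89, 56, 7),
  (17, 9, 4), (36, 29, 2), (72, 43, 6), (74, 18, 5), (65, 22, 12), (68, 40, 20),
  (83, 33, 15), (64, 42, 25), (100, 24, 3), (84, 36, 11), (82, 35, 8), (75, 34, 19),
  (85, 52, 14), (69, 37, 21), (73, 33, 31), (86, 56, 1), (67, 37, 13), (79, 39, 28),
  (32, 10, 6), (74, 41, 27), (77, 47, 16), (64, 26, 4), (108, 17, 2), (72, 46, 29),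
  (96, 25, 5), (65, 38, 23), (87, 52, 8), (82, 39, 15), (73, 32, 26), (69, 41, 3),
  (37, 16, 11), (71, 47, 25), (75, 44, 17), (66, 19, 14), (82, 48, 7), (96, 23, 9),
  (94, 58, 1), (67, 17, 6), (74, 35, 29), (71, 34, 10), (68, 37, 23), (66, 42, 21),
  (40, 27, 4), (81, 45, 2), (72, 42, 18), (19, 8, 5), (65, 47, 20), (90, 58, 6),
  (69, 19, 15), (77, 38, 24), (68, 36, 3), (86, 32, 11), (66, 41, 26), (75, 39, 16),
  (80, 32, 14), (33, 17, 8), (103, 16, 13), (74, 49, 6), (74, 51, 7), (68, 49, 9),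
  (68, 52, 13), (70, 51, 8), (73, 51, 6), (70, 54, 12), (69, 53, 8), (68, 54, 8),
  (64, 58, 7), (69, 51, 9), (66, 57, 7), (71, 55, 9), (71, 49, 8), (66, 52, 12),
  (66, 55, 13), (69, 55, 12), (64, 56, 6), (71, 53, 13), (64, 54, 13), (66, 59, 6),
  (106, 24, 7), (64, 36, 9), (70, 43, 18), (78, 35, 22), (79, 34, 20), (80, 49, 12),
  (76, 33, 21), (73, 49, 7), (70, 52, 9), (64, 53, 12)]

/-- The point sets of the codewords as bit masks. -/
def masks : List ℕ := [
  14355223812243506, 830767497365572605054838147907584004,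
  249230249209685896727676946558746626, 86330762264960701596704,
  124615124604837080579973875893272704, 10403315139225847304,
  2469098495705909264, 51922968585726077133149580977766404,
  722522071879055717695640, 23204,
  1339612589501990287565235733055668736, 685383185326937258649828822595141664,
  906749704943193009733634, 170182721835338114964352510570365194240,
  12710742709693258034642655013930831880, 4049991549657165550253787136791677954,
  31153781151209131793568491221549064, 170224260210205826780350274324505036800,
  180951545519938742854287797073320363024, 13292279957849205952704306674139136004,
  3323069989462295594441556224565592064, 1006633154,
  327053854877920225611230050517504, 83077384799948511328206349993508864,
  10058565345796523570235966464, 42535306006361399847895640350260199424,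
  324637405573613905830416402616320, 22596875928425776795098589575436566544,
  26164308388710654846891954326732804, 2606289634073980462845452389187840,
  175458095484460916519720081170410504224, 10633844248693766375361059668787462144,
  2658496556427725266824879604152467456, 2596247466888412896165466824802304,
  41538691858302291728675783879819264, 498643040105776317372743174477316104,
  1300609515843681885895793559209984, 10389664321889600441545756554297344,
  85070592047302046206752547122188386304, 90073368010768384,
  1298727856645858450959288407957504, 664619078398454722092742780819472384,
  14913308910766065499175387906, 5316912062986796173240323784294006784,
  83401268367889152981741415111327744, 162417733759295097754875854849024,
  4612821264218722304, 1329238137299205078966977580750602240,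
  353076228470329614443040480352534544, 6044721331793514421616644,
  170141224045095484385996747684030971904, 95707092974581624869570069377355743264,
  2658457264172192168144082596293246976, 22818349116942039235599462834176,
  580981978501775360, 207691874498553461691121731779952704,
  475369003419784932674739634184, 319308712697334649256413184,
  11682670407583735891870945340555264, 42535300935720955550608959085136052224,
  2308235555374383104, 21267729063435084170291996692572012544,
  669808196226893106424536271525773440, 211157772152834,
  1329228155479181088868275881460629504, 103856236831823406934497087300567104,
  39652785791272512484802561024, 170141183539702381064958712741200134144,
  10633864531175905843397953044506476544, 45196510264393236305907096875711070224,
  2815436967116804, 21267668219920022497643844484901896192,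
  171345801902379488525737407119622176, 621397352908373282525348096,
  5316912319859355358983205304437571584, 297246441292857344,
  42836449392397928070555217285873664, 7608688966464686043626383343624,
  2477166923437342528395806720, 342691592819250054213300204733464704,
  81763463752573515236897458225664, 82407202206555931200503393828864,
  85070592997904861138642076951824564224, 664938516466063639274385696075284480,
  15577128260092025678604269619707906, 19884449807527236212944273664,
  5400153527454250403493910755953229824, 288547585801585664,
  664616533348401488118315320816697344, 13835061353829629954,
  164416420224783592260173840, 415383773441586995990050701878231044,
  628646222353066335464981504, 37299833014321184,
  85070594266773756407704695379375161344, 1225128632235065360,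
  1740853180245066011576934404, 41538456572325936806286835436748800,
  126937211059536063344148584, 162338505010653987153204190644224,
  10465723433006631274466931988496384, 163526927467515672701953011384320,
  42576834241242869406349286990078296064, 2533313445691400,
  21932261950296838157706571242805397504, 54043401687662594,
  85070612012682905293621548333771259904, 83076829274280324077971704084692992,
  7507429339806847174925362304, 162576809658216460633371020624384,
  9367487784366899264, 1379203853369434509663621976424464,
  6338253756719784277621866496004, 328832840449567184786624512,
  43864523883185144512962478246673252384, 20769821260648387344177327255977984,
  21267648100918499328872295938209611776, 170146459422267381622456332994694119424,
  10675688127351864259214885107756171520, 7975367974883580555447454515956023304,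
  288794460010317824, 10394734931543477949503975198818304,
  166153697543558553317373240031576064, 4956607666336186790544687104,
  332347564384407471801532729046073344, 667210147559665463347567731685720064,
  14563778233169985889370114, 50706024160392477468753217470464,
  85672937779906208151117436760883200, 43199909863324086582473673919462114304,
  60850942631072870790366171758594, 21270244080989130462892135060542586880,
  88269046636195547551915975565639696, 101808188830829673807703976183044,
  5316913250867639694667592367817621504, 1460333513223594535189940243791904,
  5387515051597164255451228930064, 5764607545851248644,
  1298232670965818985534589539221504, 373851078242208616286502470870433824,
  29710561053529591042252210184, 1188985760943048704,
  85081301476330644061942196755509837824, 41540920073037170774080083181174784,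
  110125064, 334664864962915190930990885242880,
  674998631842578868483894925275955264, 63802944748413912070554790019205169154,
  6490380976688996394944894540447744, 21352027827112245828342139516715532544,
  5322433869154257658888147880556626944, 289426919950123264,
  5316912621916724362390632759541366784, 10785552592278775561453198901264,
  49517604522894262789577113604, 332631517504727825209362394648674304,
  365083372868165037927945021161504, 334903147684981428791149395175276544,
  85070601873915297845189522318283505664, 30463229695660565505737880535040,
  85112130144721811447282540742822600704, 121694464875465588749804897304584,
  2638297811725002441865013546199104, 12980742165698772227552677015322624,
  1318356624426253236871528940830784, 25353012023749201884201363718144,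
  42535296023576201928817481270486368256, 664614314807526140298640416711901184,
  255211775191632302626994991604634222594, 10633824602580507323561927968418693120,
  2741532751211118227966761157938651136, 577032507006977024,
  405668308598671801537911670702144, 166154769599613689602511813216436224,
  20712299393866264477696016, 12676506003758033540906745856004,
  42535377034369808519111180600836358144, 1426266503464967473933175488544,
  21267688497397204122114927181929906176, 7788445297549207016360233328967680,
  39737037455744, 5358470798873870792842571346228806144,
  432503893908258824, 1240660712675323551396399104,
  10384915582084336977460983818092544, 657695785985462664098484224,
  1662833148173941062301229042997673984, 20774258113911549674322077846339584,
  664776262121047325439597874836930560, 15950735949422617252304541805027786754,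
  2658456308791966960548492538013548544, 83157881850852517605458327292084224,
  1299343104382904857718642914100224, 166158570094860571328783279463071744,
  332388128623338655091653498439204864, 1346878763996872336394554441744,
  792378339208257582265689702404, 85070753999414970115874582937661865984,
  2377901172401897504, 324677010059050012707593518063616,
  1729454824680063104, 2185331264,
  41548535880139965039622193675239424, 44566294761456045382309380104,
  624410480978861148629633024, 42545723558954785347978537809556279296,
  1331824149165981222793708233744711680, 21288417120766505801528406555146338304,
  5212579577623507567326160519954432, 170805797460847241153266902490125697280,
  243388915247361820002295807475714, 332308266599247195677542858809933824,
  83077066668550186032663079885471744, 2341874040690443264,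
  85071889809401085287757157413031051264, 5249484736598950485340628975744,
  287449616, 720576286661017604,
  3169126807524394934249162014784, 10213628676480126061094633504,
  2630773736102373060297887744, 1329552514339783521751032628947976192,
  42556065057512878807134456424616198144, 41619505125663265801630168691769344,
  191408842801883287752212830150849462280, 10639016302771285881105130648347084800,
  2668840586529677143628522735269839104, 5316952548268393583709847128644255744,
  2596309400158147434103094420455424, 166153578702486514493020076377112576,
  664634280379442289922315513027887104, 3894222876014878303579455904284674,
  167329879532505309855048743788544, 83097032156436763770097538831482880,
  22269405434944, 1329228629612652728124796644626530304,
  20769514250460806805479161675710464, 21044980981446113927488339984,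
  212678101918354831798243045424958668804, 10633829036920418244744535641386123264,
  23926106538657848682991667672298553376, 5202438140707942813130109394878464,
  162932870953090678358761730474240, 5483065492521133993289706488815714304,
  41578939697166775947205018338197504, 2920666982927611428486077371908104,
  4620763723999545344, 10404895933716296694965909149712384,
  332317141389008614584267572156432384, 39616574740422100264820424704,
  2852257371843058590289867309184, 85735246372174443619900740877210878464,
  3862372922571251148813722714114, 24179254262055531884707904,
  83117314710525944385625902037336064, 2598683730621347183762621731963904,
  332307157412225698460575202262646784, 42535316147681654172513275140326293504,
  38299290812022800, 106338239662805359090500887036035072004,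
  5192615009129646409806007134060544, 1212686624,
  5318210057392982862220118636006211584, 5156020263625049996835610951744,
  696360751859768242186256384, 41700634183944580958441804203556864,
  713053465284710185574546276360, 42867602874044428467886164960803293184,
  10546853303383952231027933135765504, 21267972453588230250726348974240890880,
  85075784046901400247857951754871128064, 72341276661514496,
  5981617251875337860584039534429282304, 53169119831396729363518531551090442304,
  87729047721804617616851404685171490944, 21433801432031919861521866399011570176,
  42540488161975852500579846131646734336, 42701449364590725829660038738328158464,
  26584559915698931365730173258553098304, 21272840229417208864453240431468089344,
  1334420292643602408870449952430489856, 5337681170573878659770681737051373824,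
  47852207848256973806761113063989969024, 170473490459415536848363273929948660224,
  31901471898837981618529957306775371904, 2663648288428671170722004524452545024,
  85402898729181451658307330510451376384, 5649218982086194765159621151988649984,
  1495381495258634894037825725411631104, 85091360917668765211999039490577403904,
  86399819726019532942469567321808568384, 170161952647903392292931663407897124864,
  10966130965225707086225079300482146304, 172799639452039063849312103072152944704,
  187652853652985254762359971062481024, 650304757926544862712874835902976,
  170141832497595892578990448796301000704, 10634473003696431077969278753921040384,
  2659105031153633140759762712677842944, 649200516610967249783187067375616,
  1329877033511278303868293032313880576, 171470411456254459280797557521211457664,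
  10654593153714071939556353108399358464, 2824609491043021806384182378459303936]

theorem length_code : code.length = 304 := by decide +kernel

theorem good_code : ∀ t ∈ code, good t := by decide +kernel

theorem masks_eq : code.map (fun t => mask (pts t)) = masks := by decide +kernel

theorem chk_masks : chk masks = true := by decide +kernel

theorem code_pairwise :
    code.Pairwise (fun s t => ok (mask (pts s)) (mask (pts t)) = true) := by
  have h := chk_spec chk_masks
  rw [← masks_eq, List.pairwise_map] at h
  exact h

/-- The codewords. -/
def cw (i : Fin code.length) : Submodule (ZMod 2) (Fin 7 → ZMod 2) := sp (code.get i)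

theorem finrank_cw (i : Fin code.length) : finrank (ZMod 2) (cw i) = 3 :=
  finrank_sp (good_code _ (List.get_mem _ _))

theorem cw_inf {i j : Fin code.length} (h : i ≠ j) : finrank (ZMod 2) ↥(cw i ⊓ cw j) ≤ 1 := by
  have hp := List.pairwise_iff_get.1 code_pairwise
  have hg := fun i : Fin code.length => good_code _ (List.get_mem code i)
  rcases lt_or_gt_of_ne h with h | h
  · exact finrank_inf_le (hg i) (hg j) (hp i j h)
  · rw [inf_comm]
    exact finrank_inf_le (hg j) (hg i) (hp j i h)

theorem cw_injective : Function.Injective cw := by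
  intro i j h
  by_contra hne
  have h1 := cw_inf hne
  rw [← h, inf_idem, finrank_cw] at h1
  omega

end GFCode

/-- There exist 304$ three-dimensional subspaces of `GF(2)^7` such
that any two distinct ones intersect in a subspace of dimension at most 1;
equivalently, a constant dimension code in `GF(2)^7` of dimension 3 with 304
codewords and minimum subspace distance at least 4, so `A_2(7,4,3) ≥ 304`. -/
theorem exists_code_GF2_7_dim3_card_304 :
    ∃ C : Set (Submodule (ZMod 2) (Fin 7 → ZMod 2)),
      C.ncard = 304 ∧
      (∀ V ∈ C, finrank (ZMod 2) ↥V = 3) ∧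
      (∀ V ∈ C, ∀ W ∈ C, V ≠ W → finrank (ZMod 2) ↥(V ⊓ W) ≤ 1) ∧
      (∀ V ∈ C, ∀ W ∈ C, V ≠ W → 4 ≤ subspaceDist (ZMod 2) V W) := by
  refine ⟨Set.range GFCode.cw, ?_, ?_, ?_, ?_⟩
  · rw [← Set.image_univ, Set.ncard_image_of_injective _ GFCode.cw_injective, Set.ncard_univ,
      Nat.card_eq_fintype_card, Fintype.card_fin, GFCode.length_code]
  · rintro _ ⟨i, rfl⟩
    exact GFCode.finrank_cw i
  · rintro _ ⟨i, rfl⟩ _ ⟨j, rfl⟩ h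
    exact GFCode.cw_inf (fun hij => h (congrArg _ hij))
  · rintro _ ⟨i, rfl⟩ _ ⟨j, rfl⟩ h
    have h1 := GFCode.cw_inf (fun hij => h (congrArg _ hij))
    have h2 := Submodule.finrank_sup_add_finrank_inf_eq (GFCode.cw i) (GFCode.cw j)
    rw [GFCode.finrank_cw, GFCode.finrank_cw] at h2
    unfold subspaceDist
    omega
end

section
/- There exist 1275 three-dimensional subspaces of GF(2)^8 such that any two distinct ones intersect in a subspace of dimension at most 1; equivalently, there is a constant dimension code in GF(2)^8 of dimension 3 with 1275 = 5·255 codewords and minimum subspace distance at least 4, so A_2(8,4,3) ≥ 1275. -/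
open Module

namespace SingerCode

/-- Powers of the primitive element, one byte each. -/
def expTab : ℕ := 70160881166704368827218703435136616750530459438269794890424969378298545675077208731798828898087927652446353395360628748027273188182808436399538186061104243134188885576122562338679313492324190829158544377810568631194580132524405266702234305646236648896994794467054525044798919765581988418950285252905306116225263236585714808161311289784028762024137133735135393922581566890382566480334369299400480864790538739986285574563168380416343369614948461817839620668187777978661530364712890858126432457562886306102556561631759900551331094983229723298224611133722330829711659991602983068895685602467964643306841827719562658305
/-- Discrete logarithms, one byte each. -/
def logTab : ℕ := 22135253156888987530748098150270024343632497605293634117281264061560962248099620766229961468867162294233796152347975563017024165690400661622462404646302566225833645086064538892198543335321514950294300187779610338557442029018619797274438901674641748676613670242915365385819254959901651105240253464034662486586186382979728982817772067067513442677601938078891989292316012868233806586592927239821351197800766822366321181463280924672822998103315976779850880337712374790938628529953751181886374687897611504386983350015558142994211516619836411558782076806704747441947939324473761869443721989389604670425385080942269787340800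
/-- For every quotient, the orbit index and the logarithm of the denominator. -/
def ratTab : ℕ := 62493594077458956785342110403909442390995069192148619336272868482004039187765607245286245059457690068418810211340016227531748980860185993898532902922808479938199716574012104939996494757954966264564410207163988069192409519895947623897018918235614079613162080774020627094164746408955231778005503994262925200366734518812202231517131342201595377637634823445119414630319430794348058551960056046778614405211070126888301793399905847425065424165771126572505741426887885885718536248655947624703709745038585696610012950457036949926290832425772236364883633149878223343672932386072958923854709147232492816572572488591952934645704001625629100717672539780971782069056250649411897871055895367790693745021386698083356313061611262112952418504822378786449414802359164750238579199526497532135742446318927787752054060993255757302087562439731376088157308168385406465412956218063715685421382962301216053740991928233437035735508902481907461756105848535230284241218428544520683955795612069328265449687323146926271908189743782465827938801764740214774173653257742696923992594243286821639741312380009724451793950634701832808731471077376843194459226353656995067535755795470476178532019308421825488313208453457171611503857341752580873185880398392236965888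
/-- Logarithms of the nonzero vectors of the five orbit representatives. -/
def reps (j : ℕ) : List ℕ :=
  match j with
  | 0 => [0, 51, 81, 117, 122, 160, 238]
  | 1 => [0, 1, 7, 25, 112, 192, 247]
  | 2 => [0, 11, 76, 113, 173, 232, 245]
  | 3 => [0, 44, 75, 89, 199, 203, 215]
  | _ => [0, 26, 151, 178, 198, 220, 252]

def expo (i : ℕ) : ℕ := (expTab >>> (8 * (i % 255))) % 256
def logo (x : ℕ) : ℕ := (logTab >>> (8 * x)) % 256
def rat (d : ℕ) : ℕ := (ratTab >>> (16 * d)) % 65536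
def third (l m : ℕ) : ℕ := logo (Nat.xor (expo l) (expo m))

def checkLog : Bool :=
  (List.range 255).all fun i => Nat.beq (logo (expo i)) i && !(Nat.beq (expo i) 0)
def checkRat : Bool :=
  (List.range 5).all fun j => (reps j).all fun l => (reps j).all fun m =>
    Nat.beq l m || Nat.beq (rat ((m + 255 - l) % 255)) (j * 256 + l)
def checkReps : Bool :=
  (List.range 5).all fun j => (reps j).all fun l => Nat.blt l 255 &&
    (reps j).all fun m => Nat.beq l m || (reps j).any fun n => Nat.beq n (third l m)
def checkAdd : Bool :=
  (List.range 5).all fun j => (reps j).all fun l => (reps j).all fun m =>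
    Nat.beq l m || (List.range 255).all fun i =>
      Nat.beq (Nat.xor (expo (i + l)) (expo (i + m))) (expo (i + third l m))

theorem checkLog_eq : checkLog = true := by decide +kernel
theorem checkRat_eq : checkRat = true := by decide +kernel
theorem checkReps_eq : checkReps = true := by decide +kernel
theorem checkAdd_eq : checkAdd = true := by decide +kernel

theorem logo_expo (i : ℕ) (hi : i < 255) : logo (expo i) = i ∧ expo i ≠ 0 := by
  have h := checkLog_eq
  simp only [checkLog, List.all_eq_true, List.mem_range] at h
  have := h i hi
  rw [Bool.and_eq_true] at this
  refine ⟨Nat.eq_of_beq_eq_true this.1, fun h0 => ?_⟩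
  rw [h0] at this
  exact absurd this.2 (by decide)

theorem rat_eq {j l m : ℕ} (hj : j < 5) (hl : l ∈ reps j) (hm : m ∈ reps j) (hne : l ≠ m) :
    rat ((m + 255 - l) % 255) = j * 256 + l := by
  have h := checkRat_eq
  simp only [checkRat, List.all_eq_true, List.mem_range] at h
  have := h j hj l hl m hm
  simpa [hne] using this

theorem reps_lt {j l : ℕ} (hj : j < 5) (hl : l ∈ reps j) : l < 255 := by
  have h := checkReps_eq
  simp only [checkReps, List.all_eq_true, List.mem_range, Bool.and_eq_true] at h
  have := (h j hj l hl).1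
  simpa using this

theorem third_mem {j l m : ℕ} (hj : j < 5) (hl : l ∈ reps j) (hm : m ∈ reps j) (hne : l ≠ m) :
    third l m ∈ reps j := by
  have h := checkReps_eq
  simp only [checkReps, List.all_eq_true, List.mem_range, Bool.and_eq_true] at h
  have := (h j hj l hl).2 m hm
  simpa [hne] using this

theorem expo_add {i j l m : ℕ} (hi : i < 255) (hj : j < 5) (hl : l ∈ reps j) (hm : m ∈ reps j)
    (hne : l ≠ m) : expo (i + l) ^^^ expo (i + m) = expo (i + third l m) := by
  have h := checkAdd_eq
  simp only [checkAdd, List.all_eq_true, List.mem_range, Bool.or_eq_true] at h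
  have := (h j hj l hl m hm).resolve_left (by simpa using hne) i hi
  exact Nat.eq_of_beq_eq_true this

/-- The vector of binary digits. -/
def bits (n : ℕ) : Fin 8 → ZMod 2 := fun i => if n.testBit i then 1 else 0

theorem bits_xor (a b : ℕ) : bits (a ^^^ b) = bits a + bits b := by
  funext i
  simp only [bits, Nat.testBit_xor, Pi.add_apply]
  cases a.testBit i <;> cases b.testBit i <;> decide

theorem bits_inj {a b : ℕ} (ha : a < 256) (hb : b < 256) (h : bits a = bits b) : a = b := by
  apply Nat.eq_of_testBit_eq
  intro i
  by_cases hi : i < 8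
  · have := congrFun h ⟨i, hi⟩
    simp only [bits] at this
    revert this
    cases a.testBit i <;> cases b.testBit i <;> decide
  · have h8 : 2 ^ 8 ≤ 2 ^ i := Nat.pow_le_pow_right (by norm_num) (by omega)
    rw [Nat.testBit_lt_two_pow (by omega), Nat.testBit_lt_two_pow (by omega)]

theorem bits_zero : bits 0 = 0 := by
  funext i; simp [bits]

/-- The vector of the `i`-th power of the primitive element. -/
def pw (i : ℕ) : Fin 8 → ZMod 2 := bits (expo i)

theorem expo_lt (i : ℕ) : expo i < 256 := Nat.mod_lt _ (by norm_num)

theorem expo_mod (i : ℕ) : expo (i % 255) = expo i := by simp [expo]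

theorem pw_inj {a b : ℕ} (h : pw a = pw b) : a % 255 = b % 255 := by
  have h1 := bits_inj (expo_lt a) (expo_lt b) h
  rw [← expo_mod a, ← expo_mod b] at h1
  rw [← (logo_expo (a % 255) (Nat.mod_lt _ (by norm_num))).1, h1,
    (logo_expo (b % 255) (Nat.mod_lt _ (by norm_num))).1]

theorem pw_ne (a : ℕ) : pw a ≠ 0 := by
  intro h
  rw [← bits_zero] at h
  have h1 := bits_inj (expo_lt a) (by norm_num) h
  rw [← expo_mod a] at h1
  exact (logo_expo (a % 255) (Nat.mod_lt _ (by norm_num))).2 h1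

/-- The codewords: the orbit representatives multiplied by powers of the primitive element. -/
def word (k : Fin 5 × Fin 255) : Submodule (ZMod 2) (Fin 8 → ZMod 2) where
  carrier := insert 0 ((fun l => pw (k.2 + l)) '' {l | l ∈ reps k.1})
  zero_mem' := Set.mem_insert _ _
  add_mem' := by
    rintro a b (rfl | ⟨l, hl, rfl⟩) (rfl | ⟨m, hm, rfl⟩)
    · left; simp
    · right; exact ⟨m, hm, by simp⟩
    · right; exact ⟨l, hl, by simp⟩
    · by_cases hne : l = m
      · left
        subst hne
        exact CharTwo.add_self_eq_zero _
      · right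
        refine ⟨third l m, third_mem k.1.2 hl hm hne, ?_⟩
        simp only [pw]
        rw [← bits_xor, expo_add k.2.2 k.1.2 hl hm hne]
  smul_mem' := by
    intro c x hx
    have hc : c = 0 ∨ c = 1 := by revert c; decide
    rcases hc with rfl | rfl
    · left; simp
    · simpa using hx

theorem mem_word {k : Fin 5 × Fin 255} {x : Fin 8 → ZMod 2} :
    x ∈ word k ↔ x = 0 ∨ ∃ l ∈ reps k.1, pw (k.2 + l) = x := Iff.rfl

theorem word_eq {k k' : Fin 5 × Fin 255} {u v : Fin 8 → ZMod 2} (huv : u ≠ v) (hu : u ≠ 0)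
    (hv : v ≠ 0) (h1 : u ∈ word k) (h2 : v ∈ word k) (h3 : u ∈ word k') (h4 : v ∈ word k') :
    k = k' := by
  obtain ⟨l, hl, rfl⟩ := (mem_word.1 h1).resolve_left hu
  obtain ⟨m, hm, rfl⟩ := (mem_word.1 h2).resolve_left hv
  obtain ⟨l', hl', e1⟩ := (mem_word.1 h3).resolve_left hu
  obtain ⟨m', hm', e2⟩ := (mem_word.1 h4).resolve_left hv
  have hlm : l ≠ m := by rintro rfl; exact huv rfl
  have hlm' : l' ≠ m' := by rintro rfl; exact huv (e1.symm.trans e2)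
  have f1 := pw_inj e1
  have f2 := pw_inj e2
  have r1 := rat_eq k.1.2 hl hm hlm
  have r2 := rat_eq k'.1.2 hl' hm' hlm'
  have a1 := reps_lt k.1.2 hl
  have a2 := reps_lt k.1.2 hm
  have a3 := reps_lt k'.1.2 hl'
  have a4 := reps_lt k'.1.2 hm'
  have hd : (m + 255 - l) % 255 = (m' + 255 - l') % 255 := by omega
  rw [hd, r2] at r1
  have b1 := k.2.2
  have b2 := k'.2.2
  refine Prod.ext (Fin.ext ?_) (Fin.ext ?_) <;> omega

theorem reps_spec (j : Fin 5) : (reps j).toFinset.card = 7 := by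
  revert j; decide

theorem card_word (k : Fin 5 × Fin 255) : Nat.card (word k) = 8 := by
  have h : (word k : Set (Fin 8 → ZMod 2)).ncard = 8 := by
    change (insert 0 ((fun l => pw (k.2 + l)) '' {l | l ∈ reps k.1})).ncard = 8
    have hs : {l | l ∈ reps k.1} = ((reps k.1).toFinset : Set ℕ) := by ext; simp
    rw [hs, Set.ncard_insert_of_notMem, Set.InjOn.ncard_image, Set.ncard_coe_finset, reps_spec]
    · intro l hl m hm h
      have f := pw_inj h
      have a1 := reps_lt k.1.2 (List.mem_toFinset.1 hl)
      have a2 := reps_lt k.1.2 (List.mem_toFinset.1 hm)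
      omega
    · rintro ⟨l, -, h⟩
      exact pw_ne _ h
  exact h

theorem finrank_word (k : Fin 5 × Fin 255) : finrank (ZMod 2) (word k) = 3 := by
  have h := Module.natCard_eq_pow_finrank (K := ZMod 2) (V := word k)
  rw [card_word, Nat.card_zmod] at h
  exact (Nat.pow_right_injective (le_refl 2) (h.symm.trans (by norm_num : 8 = 2 ^ 3)))

theorem exists_pair (U : Submodule (ZMod 2) (Fin 8 → ZMod 2)) (h : 2 ≤ finrank (ZMod 2) U) :
    ∃ u ∈ U, ∃ v ∈ U, u ≠ v ∧ u ≠ 0 ∧ v ≠ 0 := by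
  have hc := Module.natCard_eq_pow_finrank (K := ZMod 2) (V := U)
  rw [Nat.card_zmod] at hc
  have h4 : 2 ^ 2 ≤ Nat.card U := hc ▸ Nat.pow_le_pow_right (by norm_num) h
  have h5 : (U : Set (Fin 8 → ZMod 2)).ncard = Nat.card U := rfl
  have h6 : ((U : Set (Fin 8 → ZMod 2)) \ {0}).ncard + 1 = (U : Set (Fin 8 → ZMod 2)).ncard :=
    Set.ncard_sdiff_singleton_add_one U.zero_mem
  obtain ⟨u, v, hu, hv, huv⟩ := (Set.one_lt_ncard_iff (Set.toFinite _)).1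
    (by omega : 1 < ((U : Set (Fin 8 → ZMod 2)) \ {0}).ncard)
  exact ⟨u, hu.1, v, hv.1, huv, hu.2, hv.2⟩

theorem word_injective : Function.Injective word := by
  intro k k' h
  obtain ⟨u, hu, v, hv, huv, hu0, hv0⟩ := exists_pair (word k) (by rw [finrank_word]; norm_num)
  exact word_eq huv hu0 hv0 hu hv (h ▸ hu) (h ▸ hv)

theorem finrank_inf (k k' : Fin 5 × Fin 255) (h : word k ≠ word k') :
    finrank (ZMod 2) ↥(word k ⊓ word k') ≤ 1 := by
  by_contra hc
  obtain ⟨u, hu, v, hv, huv, hu0, hv0⟩ := exists_pair (word k ⊓ word k') (by omega)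
  exact h (congrArg word (word_eq huv hu0 hv0 hu.1 hv.1 hu.2 hv.2))

end SingerCode

/-- There exist 1275$ three-dimensional subspaces of `GF(2)^8` such
that any two distinct ones intersect in a subspace of dimension at most 1;
equivalently, a constant dimension code in `GF(2)^8` of dimension 3 with 1275
codewords and minimum subspace distance at least 4, so `A_2(8,4,3) ≥ 1275`. -/
theorem exists_code_GF2_8_dim3_card_1275 :
    ∃ C : Set (Submodule (ZMod 2) (Fin 8 → ZMod 2)),
      C.ncard = 1275 ∧
      (∀ V ∈ C, finrank (ZMod 2) ↥V = 3) ∧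
      (∀ V ∈ C, ∀ W ∈ C, V ≠ W → finrank (ZMod 2) ↥(V ⊓ W) ≤ 1) ∧
      (∀ V ∈ C, ∀ W ∈ C, V ≠ W → 4 ≤ subspaceDist (ZMod 2) V W) := by
  refine ⟨Set.range SingerCode.word, ?_, ?_, ?_, ?_⟩
  · rw [Set.ncard_range_of_injective SingerCode.word_injective]
    simp
  · rintro _ ⟨k, rfl⟩
    exact SingerCode.finrank_word k
  · rintro _ ⟨k, rfl⟩ _ ⟨k', rfl⟩ h
    exact SingerCode.finrank_inf k k' h
  · rintro _ ⟨k, rfl⟩ _ ⟨k', rfl⟩ h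
    have h1 := SingerCode.finrank_inf k k' h
    have h2 := Submodule.finrank_sup_add_finrank_inf_eq (SingerCode.word k) (SingerCode.word k')
    rw [SingerCode.finrank_word, SingerCode.finrank_word] at h2
    unfold subspaceDist
    omega
end

section
/- There exist 5621 three-dimensional subspaces of GF(2)^9 such that any two distinct ones intersect in a subspace of dimension at most 1; equivalently, there is a constant dimension code in GF(2)^9 of dimension 3 with 5621 = 11·511 codewords and minimum subspace distance at least 4, so A_2(9,4,3) ≥ 5621. -/
open Module

namespace Code5621

/-- Multiplication by `x` modulo `x^9 + x^4 + 1` on bit-coded polynomials. -/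
def step (n : ℕ) : ℕ := Nat.xor (2 * n) (529 * (n / 256))

/-- The vector coded by the bits of `n`. -/
def phi (n : ℕ) : Fin 9 → ZMod 2 := fun i => if n.testBit i then 1 else 0

/-- The Singer cycle as a linear map. -/
def T : (Fin 9 → ZMod 2) →ₗ[ZMod 2] (Fin 9 → ZMod 2) where
  toFun x := ![x 8, x 0, x 1, x 2, x 3 + x 8, x 4, x 5, x 6, x 7]
  map_add' x y := by
    funext i
    fin_cases i <;> simp <;> ring
  map_smul' c x := by
    funext i
    fin_cases i <;> simp <;> ring

/-- `D j w` is the discrete logarithm of the element with coordinates `w` of the `j`-th plane. -/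
def D : Fin 11 → Fin 8 → ℕ :=
  ![![0, 0, 391, 377, 6, 329, 406, 279],
    ![0, 0, 421, 19, 119, 49, 271, 243],
    ![0, 0, 3, 420, 310, 45, 82, 104],
    ![0, 0, 24, 294, 436, 360, 145, 321],
    ![0, 0, 192, 308, 422, 325, 138, 13],
    ![0, 0, 1, 130, 301, 47, 208, 164],
    ![0, 0, 8, 18, 364, 376, 131, 290],
    ![0, 0, 64, 144, 357, 453, 26, 276],
    ![0, 0, 2, 260, 264, 426, 71, 269],
    ![0, 0, 16, 36, 68, 342, 57, 108],
    ![0, 0, 128, 288, 33, 181, 456, 353]]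

/-- `E j w` is the bit code of the element with coordinates `w` of the `j`-th plane. -/
def E : Fin 11 → Fin 8 → ℕ :=
  ![![0, 1, 30, 31, 64, 65, 94, 95],
    ![0, 1, 18, 19, 326, 327, 340, 341],
    ![0, 1, 8, 9, 242, 243, 250, 251],
    ![0, 1, 113, 112, 215, 214, 166, 167],
    ![0, 1, 309, 308, 36, 37, 273, 272],
    ![0, 1, 2, 3, 476, 477, 478, 479],
    ![0, 1, 256, 257, 262, 263, 6, 7],
    ![0, 1, 82, 83, 406, 407, 452, 453],
    ![0, 1, 4, 5, 80, 81, 84, 85],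
    ![0, 1, 196, 197, 258, 259, 454, 455],
    ![0, 1, 396, 397, 338, 339, 222, 223]]

/-- Lookup table: the ten bits at position `10 * d` say where the difference `d` occurs. -/
def bigN : ℕ := 5917828241422801076470565883831081956538614739854488677277103581467074394265433193403116101804618169488680282840155268847201088134045837573359430195687045021200676692672001444963333560076092927015354941731650611334575675974916573811260959723901004155192076047570056917210482947687479429599280414698227213285024759943482048978138887705726058132692151404450577249504473540841763064606960312530767739425032701261798392032423496078327031170066060291278518732117448669679428912443330016896818530786912407013730918294985759401034857016741396987749296559889862033241573773994512878344373834404169577963792737903442739735808161372528781900889884747423709148291547399476556041728860584385302119220449514540371273610747015555840856527769852139028675036341847855607648049746732986597349575819840608018602938213389526955364422661817532337722706981840967086631698687947695749336573044534406852483284643980353653449181661914084519993993675163290015794461924521040519390746280454027592052485026870338409895052102825004968630747904402881672615737218478206555653501164277711128865422913125485252752029980359995455379790312631989110174069018046030990184290690179683205373035286562819850181739424341042215871171679227185971607107685765827906568712684865991898136065150925217270680193080662251488626085929426976878350246750652127743436494280996343395224029853030410247311002232063426771973325271972872067957730271944070876609397803531212486142452436825933502815474188615603064350788485021613385319462540841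8296074535366704778265574790166300383832425079587840

def lookup (d : ℕ) : ℕ := (bigN >>> (10 * d)) % 1024

def ex (k : ℕ) : ℕ := step^[k] 1

def v (k : ℕ) : Fin 9 → ZMod 2 := phi (ex k)

theorem step_facts : ∀ n : Fin 512, step n < 512 ∧ (n.val ≠ 0 → step n ≠ 0) := by
  decide +kernel

theorem phi_step : ∀ n : Fin 512, ∀ i : Fin 9, phi (step n) i = T (phi n) i := by
  decide +kernel

/-- Decoding of a vector. -/
def unphi (x : Fin 9 → ZMod 2) : ℕ :=
  (x 0).val + 2 * (x 1).val + 4 * (x 2).val + 8 * (x 3).val + 16 * (x 4).val + 32 * (x 5).val +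
    64 * (x 6).val + 128 * (x 7).val + 256 * (x 8).val

theorem unphi_phi : ∀ n : Fin 512, unphi (phi n) = n := by
  decide +kernel

theorem ex_511 : ex 511 = 1 := by decide +kernel

theorem ex_73 : ex 73 ≠ 1 := by decide +kernel

theorem ex_7 : ex 7 ≠ 1 := by decide +kernel

theorem ex_D : ∀ j : Fin 11, ∀ w : Fin 8, w ≠ 0 → ex (D j w) = E j w := by decide +kernel

def idx (w : Fin 3 → ZMod 2) : Fin 8 :=
  Fin.ofNat 8 ((w 0).val + 2 * (w 1).val + 4 * (w 2).val)

theorem idx_inj : ∀ w u : Fin 3 → ZMod 2, idx w = idx u → w = u := by decide +kernel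

theorem idx_zero : idx 0 = 0 := by decide +kernel

theorem phi_E : ∀ j : Fin 11, ∀ w : Fin 3 → ZMod 2, w ≠ 0 → ∀ i : Fin 9,
    w 0 * phi (E j 1) i + w 1 * phi (E j 2) i + w 2 * phi (E j 4) i = phi (E j (idx w)) i := by
  decide +kernel

theorem diff_lookup : ∀ j : Fin 11, ∀ w u : Fin 8, w ≠ 0 → u ≠ 0 → w ≠ u →
    lookup ((D j w + 511 - D j u) % 511) = j.val * 64 + w.val * 8 + u.val := by
  decide +kernel

theorem D_lt : ∀ j : Fin 11, ∀ w : Fin 8, D j w < 511 := by decide +kernel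

theorem ex_succ (k : ℕ) : ex (k + 1) = step (ex k) := by
  simp only [ex, Function.iterate_succ_apply']

theorem ex_facts (k : ℕ) : ex k < 512 ∧ ex k ≠ 0 := by
  induction k with
  | zero => decide
  | succ k ih =>
    rw [ex_succ]
    have h := step_facts ⟨ex k, ih.1⟩
    exact ⟨h.1, h.2 ih.2⟩

theorem v_succ (k : ℕ) : v (k + 1) = T (v k) := by
  funext i
  have h := phi_step ⟨ex k, (ex_facts k).1⟩ i
  simpa only [v, ex_succ] using h

theorem v_add (k i : ℕ) : v (k + i) = (T ^ i) (v k) := by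
  induction i with
  | zero => simp
  | succ i ih => rw [← Nat.add_assoc, v_succ, ih, pow_succ']; rfl

theorem unphi_v (k : ℕ) : unphi (v k) = ex k := unphi_phi ⟨ex k, (ex_facts k).1⟩

theorem v_ne_zero (k : ℕ) : v k ≠ 0 := by
  intro h
  have h1 := unphi_v k
  rw [h] at h1
  exact (ex_facts k).2 (h1.symm.trans (by decide))

theorem period : Function.minimalPeriod step 1 = 511 := by
  have h : Function.minimalPeriod step 1 ∣ 511 :=
    Function.IsPeriodicPt.minimalPeriod_dvd (show Function.IsPeriodicPt step 511 1 from ex_511)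
  have h2 : Function.minimalPeriod step 1 ∈ Nat.divisors 511 := by simp [h]
  have h3 : Nat.divisors 511 = {1, 7, 73, 511} := by decide +kernel
  have h4 : step^[Function.minimalPeriod step 1] 1 = 1 := Function.iterate_minimalPeriod
  rw [h3] at h2
  simp only [Finset.mem_insert, Finset.mem_singleton] at h2
  rcases h2 with h2 | h2 | h2 | h2
  · rw [h2] at h4
    exact absurd h4 (by decide)
  · rw [h2] at h4
    exact absurd h4 ex_7
  · rw [h2] at h4
    exact absurd h4 ex_73
  · exact h2

theorem v_inj {a b : ℕ} (h : v a = v b) : a % 511 = b % 511 := by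
  have h1 : ex a = ex b := by rw [← unphi_v, ← unphi_v, h]
  have ha : ex (a % 511) = ex a := by
    have := Function.iterate_mod_minimalPeriod_eq (f := step) (x := 1) (n := a)
    rwa [period] at this
  have hb : ex (b % 511) = ex b := by
    have := Function.iterate_mod_minimalPeriod_eq (f := step) (x := 1) (n := b)
    rwa [period] at this
  refine (Function.iterate_injOn_Iio_minimalPeriod (f := step) (x := 1)) ?_ ?_
    (show ex (a % 511) = ex (b % 511) by rw [ha, hb, h1])
  · rw [period]; exact Nat.mod_lt _ (by norm_num)
  · rw [period]; exact Nat.mod_lt _ (by norm_num)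

/-- Parametrisation of the `j`-th base plane. -/
def L (j : Fin 11) : (Fin 3 → ZMod 2) →ₗ[ZMod 2] (Fin 9 → ZMod 2) where
  toFun w := w 0 • phi (E j 1) + w 1 • phi (E j 2) + w 2 • phi (E j 4)
  map_add' x y := by
    simp only [Pi.add_apply, add_smul]
    abel
  map_smul' c x := by
    simp only [Pi.smul_apply, smul_eq_mul, mul_smul, smul_add, RingHom.id_apply]

theorem idx_ne {w : Fin 3 → ZMod 2} (hw : w ≠ 0) : idx w ≠ 0 := by
  intro h
  exact hw (idx_inj _ _ (h.trans idx_zero.symm))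

theorem L_apply (j : Fin 11) (w : Fin 3 → ZMod 2) (hw : w ≠ 0) : L j w = v (D j (idx w)) := by
  funext i
  have h := phi_E j w hw i
  rw [v, ex_D j _ (idx_ne hw), ← h]
  rfl

/-- Parametrisation of the shifted planes. -/
def M (p : Fin 11 × Fin 511) : (Fin 3 → ZMod 2) →ₗ[ZMod 2] (Fin 9 → ZMod 2) :=
  (T ^ p.2.val) ∘ₗ L p.1

theorem M_apply (p : Fin 11 × Fin 511) (w : Fin 3 → ZMod 2) (hw : w ≠ 0) :
    M p w = v (D p.1 (idx w) + p.2.val) := by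
  rw [v_add, ← L_apply p.1 w hw]
  rfl

theorem M_inj (p : Fin 11 × Fin 511) : Function.Injective (M p) := by
  rw [injective_iff_map_eq_zero]
  intro w h
  by_contra hw
  rw [M_apply p w hw] at h
  exact v_ne_zero _ h

/-- The codewords. -/
def U (p : Fin 11 × Fin 511) : Submodule (ZMod 2) (Fin 9 → ZMod 2) := LinearMap.range (M p)

theorem finrank_U (p : Fin 11 × Fin 511) : finrank (ZMod 2) (U p) = 3 := by
  rw [U, LinearMap.finrank_range_of_inj (M_inj p)]
  simp

theorem key (p q : Fin 11 × Fin 511) (x y : Fin 9 → ZMod 2) (hx : x ≠ 0) (hy : y ≠ 0)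
    (hxy : x ≠ y) (hxp : x ∈ U p) (hxq : x ∈ U q) (hyp : y ∈ U p) (hyq : y ∈ U q) : p = q := by
  obtain ⟨w, rfl⟩ := hxp
  obtain ⟨w', hw'⟩ := hxq
  obtain ⟨u, rfl⟩ := hyp
  obtain ⟨u', hu'⟩ := hyq
  have hw0 : w ≠ 0 := by rintro rfl; simp at hx
  have hu0 : u ≠ 0 := by rintro rfl; simp at hy
  have hw0' : w' ≠ 0 := by rintro rfl; rw [map_zero] at hw'; exact hx hw'.symm
  have hu0' : u' ≠ 0 := by rintro rfl; rw [map_zero] at hu'; exact hy hu'.symm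
  have hwu : w ≠ u := by rintro rfl; exact hxy rfl
  have hwu' : w' ≠ u' := by rintro rfl; exact hxy (hw'.symm.trans hu')
  rw [M_apply _ _ hw0, M_apply _ _ hw0'] at hw'
  rw [M_apply _ _ hu0, M_apply _ _ hu0'] at hu'
  have e1 := v_inj hw'
  have e2 := v_inj hu'
  have d1 := diff_lookup p.1 (idx w) (idx u) (idx_ne hw0) (idx_ne hu0)
    (fun h => hwu (idx_inj _ _ h))
  have d2 := diff_lookup q.1 (idx w') (idx u') (idx_ne hw0') (idx_ne hu0')
    (fun h => hwu' (idx_inj _ _ h))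
  have b1 := D_lt p.1 (idx w)
  have b2 := D_lt p.1 (idx u)
  have b3 := D_lt q.1 (idx w')
  have b4 := D_lt q.1 (idx u')
  have e3 : (D p.1 (idx w) + 511 - D p.1 (idx u)) % 511
      = (D q.1 (idx w') + 511 - D q.1 (idx u')) % 511 := by omega
  rw [e3, d2] at d1
  have c1 := (idx w).isLt
  have c2 := (idx u).isLt
  have c3 := (idx w').isLt
  have c4 := (idx u').isLt
  have f1 : p.1 = q.1 := Fin.ext (by omega)
  have f2 : idx w = idx w' := Fin.ext (by omega)
  rw [f1, f2] at e1
  have g1 := p.2.isLt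
  have g2 := q.2.isLt
  exact Prod.ext f1 (Fin.ext (by omega))

theorem inter (p q : Fin 11 × Fin 511) (hpq : p ≠ q) :
    finrank (ZMod 2) ↥(U p ⊓ U q) ≤ 1 := by
  by_contra hcon
  have h2 : 2 ≤ finrank (ZMod 2) ↥(U p ⊓ U q) := by omega
  obtain ⟨f, hf⟩ := exists_linearIndependent_of_le_finrank h2
  have h0 := hf.ne_zero 0
  have h1 := hf.ne_zero 1
  have h01 : f 0 ≠ f 1 := fun h => absurd (hf.injective h) (by decide)
  refine hpq (key p q (f 0) (f 1) ?_ ?_ ?_ (f 0).2.1 (f 0).2.2 (f 1).2.1 (f 1).2.2)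
  · simpa using h0
  · simpa using h1
  · exact fun h => h01 (Subtype.ext h)

theorem U_inj : Function.Injective U := by
  intro p q h
  by_contra hpq
  have h1 := inter p q hpq
  rw [← h, inf_idem, finrank_U] at h1
  omega

end Code5621

/-- There exist 5621$ three-dimensional subspaces of `GF(2)^9` such
that any two distinct ones intersect in a subspace of dimension at most 1;
equivalently, a constant dimension code in `GF(2)^9` of dimension 3 with 5621
codewords and minimum subspace distance at least 4, so `A_2(9,4,3) ≥ 5621`. -/
theorem exists_code_GF2_9_dim3_card_5621 :
    ∃ C : Set (Submodule (ZMod 2) (Fin 9 → ZMod 2)),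
      C.ncard = 5621 ∧
      (∀ V ∈ C, finrank (ZMod 2) ↥V = 3) ∧
      (∀ V ∈ C, ∀ W ∈ C, V ≠ W → finrank (ZMod 2) ↥(V ⊓ W) ≤ 1) ∧
      (∀ V ∈ C, ∀ W ∈ C, V ≠ W → 4 ≤ subspaceDist (ZMod 2) V W) := by
  have hint : ∀ V ∈ Set.range Code5621.U, ∀ W ∈ Set.range Code5621.U, V ≠ W →
      finrank (ZMod 2) ↥(V ⊓ W) ≤ 1 := by
    rintro _ ⟨p, rfl⟩ _ ⟨q, rfl⟩ h
    exact Code5621.inter p q (fun e => h (congrArg _ e))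
  refine ⟨Set.range Code5621.U, ?_, ?_, hint, ?_⟩
  · rw [← Set.image_univ, Set.ncard_image_of_injective _ Code5621.U_inj, Set.ncard_univ]
    simp
  · rintro _ ⟨p, rfl⟩
    exact Code5621.finrank_U p
  · rintro V hV W hW h
    have h1 := hint V hV W hW h
    have h2 := Submodule.finrank_sup_add_finrank_inf_eq V W
    obtain ⟨p, rfl⟩ := hV
    obtain ⟨q, rfl⟩ := hW
    rw [Code5621.finrank_U, Code5621.finrank_U] at h2
    unfold subspaceDist
    omega
end

section
/- There exist 79833 three-dimensional subspaces of GF(2)^11 such that any two distinct ones intersect in a subspace of dimension at most 1; equivalently, there is a constant dimension code in GF(2)^11 of dimension 3 with 79833 = 39·2047 codewords and minimum subspace distance at least 4, so A_2(11,4,3) ≥ 79833. -/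
open Module

/-! The code is a union of 39 orbits of a Singer cycle. Vectors of `GF(2)^11` are encoded by
natural numbers below `2^11`; `stp` is multiplication by the class of `X` modulo
`X^11 + X^2 + 1`. The planes are `{0} ∪ {α^s : s ∈ S}` for 39 seven-element sets `S` of exponents
all of whose differences modulo 2047 are distinct. -/

namespace SingerCode

/-- Multiplication by `X` modulo `X^11 + X^2 + 1`. -/
def stp (n : ℕ) : ℕ := if n.testBit 10 then (n <<< 1) ^^^ 2053 else n <<< 1

/-- The powers of `X`. -/
def ex (n : ℕ) : ℕ := stp^[n] 1

/-- Way points `ex (32 * j)`. -/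
def way : List ℕ :=
  [1, 1064, 1605, 324, 158, 1609, 186, 947, 380, 1586, 206, 1604, 1388, 1755, 1805, 36, 1530,
   454, 1409, 434, 118, 1442, 159, 609, 1791, 759, 482, 123, 116, 1527, 1040, 233, 1987,
   1632, 150, 1821, 652, 406, 1420, 1124, 1310, 979, 1673, 1877, 381, 538, 1675, 1792, 1522,
   146, 1975, 919, 1158, 2036, 1359, 2038, 1306, 889, 1938, 581, 773, 817, 1123, 457, 2]

/-- The exponent sets, each exponent together with its power. -/
def data : List (List (ℕ × ℕ)) :=
  [[(0, 1), (1, 2), (13, 20), (945, 21), (1029, 3), (1076, 23), (1913, 22)],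
   [(0, 1), (2, 4), (11, 5), (26, 272), (105, 277), (1779, 276), (1890, 273)],
   [(0, 1), (4, 16), (22, 17), (52, 416), (210, 433), (1511, 432), (1733, 417)],
   [(0, 1), (8, 256), (44, 257), (104, 1160), (420, 1417), (975, 1416), (1419, 1161)],
   [(0, 1), (16, 160), (88, 161), (208, 621), (791, 620), (840, 716), (1950, 717)],
   [(0, 1), (32, 1064), (176, 1065), (416, 1755), (1582, 1754), (1680, 754), (1853, 755)],
   [(0, 1), (64, 1605), (352, 1604), (832, 482), (1117, 483), (1313, 1958), (1659, 1959)],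
   [(0, 1), (128, 158), (187, 1159), (579, 1049), (704, 159), (1271, 1048), (1664, 1158)],
   [(0, 1), (256, 380), (374, 568), (495, 837), (1158, 836), (1281, 569), (1408, 381)],
   [(0, 1), (269, 570), (512, 1530), (515, 1985), (748, 1984), (769, 1531), (990, 571)],
   [(0, 1), (538, 1988), (1024, 1987), (1030, 6), (1496, 7), (1538, 1986), (1980, 1989)],
   [(0, 1), (330, 507), (358, 506), (691, 500), (708, 501), (1040, 15), (1497, 14)],
   [(0, 1), (33, 85), (660, 1479), (716, 1478), (947, 84), (1382, 1426), (1416, 1427)],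
   [(0, 1), (66, 283), (717, 905), (785, 904), (1320, 658), (1432, 659), (1894, 282)],
   [(0, 1), (132, 485), (593, 940), (817, 941), (1434, 585), (1570, 584), (1741, 484)],
   [(0, 1), (264, 1171), (821, 715), (1093, 714), (1186, 1624), (1435, 1170), (1634, 1625)],
   [(0, 1), (139, 742), (325, 463), (528, 808), (823, 809), (1221, 462), (1642, 743)],
   [(0, 1), (278, 1718), (395, 214), (650, 215), (1056, 1632), (1237, 1719), (1646, 1633)],
   [(0, 1), (65, 1167), (427, 1464), (556, 1465), (790, 310), (1245, 1166), (1300, 311)],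
   [(0, 1), (130, 632), (443, 633), (553, 1461), (854, 1997), (1112, 1996), (1580, 1460)],
   [(0, 1), (177, 87), (260, 1994), (886, 1995), (1106, 1948), (1113, 1949), (1708, 86)],
   [(0, 1), (165, 349), (179, 348), (354, 287), (520, 67), (1369, 286), (1772, 66)],
   [(0, 1), (137, 1211), (894, 29), (1170, 1191), (1175, 1210), (1318, 1190), (1498, 28)],
   [(0, 1), (274, 1896), (293, 1592), (303, 1897), (589, 1593), (949, 336), (1788, 337)],
   [(0, 1), (548, 1135), (586, 1477), (606, 1134), (1178, 1476), (1529, 427), (1898, 426)],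
   [(0, 1), (309, 663), (1011, 1229), (1096, 1626), (1172, 662), (1212, 1627), (1749, 1228)],
   [(0, 1), (145, 459), (297, 956), (377, 458), (618, 957), (1451, 631), (2022, 630)],
   [(0, 1), (290, 199), (594, 1880), (754, 198), (855, 1951), (1236, 1881), (1997, 1950)],
   [(0, 1), (425, 366), (580, 55), (1188, 367), (1508, 54), (1710, 344), (1947, 345)],
   [(0, 1), (329, 1279), (850, 1278), (969, 1300), (1160, 1301), (1373, 490), (1847, 491)],
   [(0, 1), (273, 948), (658, 1906), (699, 1222), (1647, 1223), (1700, 1907), (1938, 949)],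
   [(0, 1), (546, 1816), (1247, 562), (1316, 1323), (1353, 1322), (1398, 563), (1829, 1817)],
   [(0, 1), (447, 1924), (585, 1760), (659, 1761), (749, 1925), (1092, 357), (1611, 356)],
   [(0, 1), (211, 866), (418, 867), (742, 31), (1041, 30), (1191, 893), (1333, 892)],
   [(0, 1), (35, 340), (335, 1915), (422, 1582), (619, 1914), (836, 1583), (1484, 341)],
   [(0, 1), (70, 442), (670, 1386), (844, 1233), (921, 443), (1238, 1387), (1672, 1232)],
   [(0, 1), (140, 1484), (429, 1770), (1297, 807), (1340, 1771), (1688, 806), (1842, 1485)],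
   [(0, 1), (280, 727), (547, 1589), (633, 1250), (858, 1251), (1329, 1588), (1637, 726)],
   [(0, 1), (560, 951), (611, 1429), (1094, 1428), (1227, 950), (1266, 1571), (1716, 1570)]]

/-- The `i`-th set. -/
def blk (i : ℕ) : List (ℕ × ℕ) := data.getD i []

theorem stp_xor (a b : ℕ) : stp (a ^^^ b) = stp a ^^^ stp b := by
  unfold stp
  rw [Nat.testBit_xor, Nat.shiftLeft_xor_distrib]
  cases a.testBit 10 <;> cases b.testBit 10 <;> simp
  · rw [Nat.xor_assoc]
  · rw [Nat.xor_assoc, Nat.xor_assoc, Nat.xor_comm 2053]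
  · rw [Nat.xor_assoc, Nat.xor_comm 2053, Nat.xor_assoc (b <<< 1), Nat.xor_self, Nat.xor_zero]

theorem iter_xor (k a b : ℕ) : stp^[k] (a ^^^ b) = stp^[k] a ^^^ stp^[k] b := by
  induction k generalizing a b with
  | zero => rfl
  | succ k ih => simp only [Function.iterate_succ_apply, stp_xor, ih]

theorem stp_lt : ∀ n < 2048, stp n < 2048 := by decide +kernel

theorem ex_lt (n : ℕ) : ex n < 2048 := by
  induction n with
  | zero => decide
  | succ n ih =>
    rw [ex, Function.iterate_succ_apply']
    exact stp_lt _ ih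

theorem ex_add (s k : ℕ) : ex (s + k) = stp^[k] (ex s) := by
  rw [ex, ex, Nat.add_comm, Function.iterate_add_apply]

theorem way_step : ∀ j < 64, stp^[32] (way.getD j 0) = way.getD (j + 1) 0 := by decide +kernel

theorem ex_way (j : ℕ) (hj : j ≤ 64) : ex (32 * j) = way.getD j 0 := by
  induction j with
  | zero => rfl
  | succ j ih =>
    rw [Nat.mul_succ, ex_add, ih (by omega), way_step j (by omega)]

theorem ex_eq (s : ℕ) (hs : s ≤ 2048) : ex s = stp^[s % 32] (way.getD (s / 32) 0) := by
  conv_lhs => rw [← Nat.div_add_mod s 32]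
  rw [ex_add, ex_way _ (by omega)]

theorem minPer : Function.minimalPeriod stp 1 = 2047 := by
  have h : Function.IsPeriodicPt stp 2047 1 := by
    change ex 2047 = 1
    rw [ex_eq _ (by norm_num)]; decide +kernel
  have hd := h.minimalPeriod_dvd
  have hp := Function.iterate_minimalPeriod (f := stp) (x := 1)
  have hmem : Function.minimalPeriod stp 1 ∈ Nat.divisors 2047 := by simp [hd]
  have hdiv : Nat.divisors 2047 = {1, 23, 89, 2047} := by decide +kernel
  rw [hdiv] at hmem
  simp only [Finset.mem_insert, Finset.mem_singleton] at hmem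
  rcases hmem with h1 | h1 | h1 | h1
  · rw [h1] at hp; exact absurd hp (by decide +kernel)
  · rw [h1] at hp; exact absurd hp (by decide +kernel)
  · rw [h1] at hp; exact absurd hp (by decide +kernel)
  · exact h1

theorem ex_mod (n : ℕ) : ex (n % 2047) = ex n := by
  have := Function.iterate_mod_minimalPeriod_eq (f := stp) (x := 1) (n := n)
  rwa [minPer] at this

theorem ex_inj (n m : ℕ) (h : ex n = ex m) : n % 2047 = m % 2047 := by
  rw [← ex_mod n, ← ex_mod m] at h
  refine (Function.iterate_eq_iterate_iff_of_lt_minimalPeriod (f := stp) (x := 1) ?_ ?_).1 h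
  · rw [minPer]; omega
  · rw [minPer]; omega

theorem ex_ne_zero (n : ℕ) : ex n ≠ 0 := by
  intro h
  have h1 : ex (n + 1) = ex n := by
    rw [ex_add, h]; decide
  have := ex_inj _ _ h1
  omega

/-! ### Checks on the data -/

theorem data_val : ∀ B ∈ data, ∀ p ∈ B,
    p.1 < 2047 ∧ stp^[p.1 % 32] (way.getD (p.1 / 32) 0) = p.2 := by decide +kernel

theorem data_closed : ∀ B ∈ data, ∀ p ∈ B, ∀ q ∈ B, p.2 = q.2 ∨
    ∃ r ∈ B, p.2 ^^^ q.2 = r.2 := by decide +kernel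

theorem data_card : ∀ B ∈ data, (B.map Prod.fst).Nodup ∧ B.length = 7 := by decide +kernel

/-- All (block, exponent, exponent) triples with distinct exponents. -/
def trip : List (ℕ × ℕ × ℕ) :=
  (List.range 39).flatMap fun i => (blk i).flatMap fun p =>
    ((blk i).filter fun q => !(p.1 == q.1)).map fun q => (i, p.1, q.1)

/-- Fast distinctness test with a bit mask. -/
def chk : List ℕ → ℕ → Bool
  | [], _ => true
  | d :: l, acc => !acc.testBit d && chk l (acc ||| (1 <<< d))

theorem chk_sound (l : List ℕ) (acc : ℕ) (h : chk l acc = true) :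
    l.Nodup ∧ ∀ d ∈ l, acc.testBit d = false := by
  induction l generalizing acc with
  | nil => simp
  | cons d l ih =>
    simp only [chk, Bool.and_eq_true, Bool.not_eq_true'] at h
    obtain ⟨h1, h2⟩ := ih _ h.2
    simp only [Nat.testBit_or, Bool.or_eq_false_iff] at h2
    refine ⟨List.nodup_cons.2 ⟨fun hd => ?_, h1⟩, ?_⟩
    · have := (h2 d hd).2
      simp [Nat.testBit_shiftLeft] at this
    · intro x hx
      rcases List.mem_cons.1 hx with rfl | hx
      · exact h.1
      · exact (h2 x hx).1

/-- The difference of a triple. -/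
def dff (x : ℕ × ℕ × ℕ) : ℕ := (x.2.1 + 2047 - x.2.2) % 2047

theorem trip_chk : chk (trip.map dff) 0 = true := by decide +kernel

theorem blk_mem {i : ℕ} (hi : i < 39) : blk i ∈ data := by
  have hl : data.length = 39 := by decide +kernel
  unfold blk
  rw [List.getD_eq_getElem _ _ (by omega)]
  exact List.getElem_mem _

theorem blk_val {i : ℕ} (hi : i < 39) {p : ℕ × ℕ} (hp : p ∈ blk i) :
    p.1 < 2047 ∧ ex p.1 = p.2 := by
  have h := data_val _ (blk_mem hi) p hp
  exact ⟨h.1, by rw [ex_eq _ (by omega), h.2]⟩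

theorem blk_closed {i : ℕ} (hi : i < 39) {p q : ℕ × ℕ} (hp : p ∈ blk i) (hq : q ∈ blk i)
    (k : ℕ) : ex (p.1 + k) = ex (q.1 + k) ∨
    ∃ r ∈ blk i, ex (p.1 + k) ^^^ ex (q.1 + k) = ex (r.1 + k) := by
  rcases data_closed _ (blk_mem hi) p hp q hq with h | ⟨r, hr, h⟩
  · left
    rw [ex_add, ex_add, (blk_val hi hp).2, (blk_val hi hq).2, h]
  · right
    refine ⟨r, hr, ?_⟩
    rw [ex_add, ex_add, ex_add, (blk_val hi hp).2, (blk_val hi hq).2, (blk_val hi hr).2,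
      ← iter_xor, h]

theorem trip_mem {i : ℕ} (hi : i < 39) {p q : ℕ × ℕ} (hp : p ∈ blk i) (hq : q ∈ blk i)
    (h : p.1 ≠ q.1) : (i, p.1, q.1) ∈ trip := by
  unfold trip
  refine List.mem_flatMap.2 ⟨i, List.mem_range.2 hi, List.mem_flatMap.2 ⟨p, hp, ?_⟩⟩
  exact List.mem_map.2 ⟨q, List.mem_filter.2 ⟨hq, by simpa using h⟩, rfl⟩

theorem key {i j : ℕ} (hi : i < 39) (hj : j < 39) {k l : ℕ} (hk : k < 2047) (hl : l < 2047)
    {p q p' q' : ℕ × ℕ} (hp : p ∈ blk i) (hq : q ∈ blk i) (hp' : p' ∈ blk j) (hq' : q' ∈ blk j)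
    (h1 : ex (p.1 + k) = ex (p'.1 + l)) (h2 : ex (q.1 + k) = ex (q'.1 + l))
    (hne : ex (p.1 + k) ≠ ex (q.1 + k)) : i = j ∧ k = l := by
  have n1 : p.1 ≠ q.1 := fun h => hne (by rw [h])
  have n2 : p'.1 ≠ q'.1 := fun h => hne (by rw [h1, h2, h])
  have e1 := ex_inj _ _ h1
  have e2 := ex_inj _ _ h2
  have b1 := (blk_val hi hp).1
  have b2 := (blk_val hi hq).1
  have b3 := (blk_val hj hp').1
  have b4 := (blk_val hj hq').1
  have hd : dff (i, p.1, q.1) = dff (j, p'.1, q'.1) := by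
    unfold dff
    dsimp only
    omega
  have hinj := List.inj_on_of_nodup_map (chk_sound _ _ trip_chk).1
    (trip_mem hi hp hq n1) (trip_mem hj hp' hq' n2) hd
  simp only [Prod.mk.injEq] at hinj
  obtain ⟨a, b, c⟩ := hinj
  refine ⟨a, ?_⟩
  omega

/-! ### Vectors -/

/-- The vector encoded by a number. -/
def vec (n : ℕ) : Fin 11 → ZMod 2 := fun j => if n.testBit j then 1 else 0

theorem vec_xor (a b : ℕ) : vec (a ^^^ b) = vec a + vec b := by
  funext j
  simp only [vec, Nat.testBit_xor, Pi.add_apply]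
  cases a.testBit j <;> cases b.testBit j <;> simp <;> decide

theorem vec_zero : vec 0 = 0 := by
  funext j
  simp [vec]

theorem vec_inj {a b : ℕ} (ha : a < 2048) (hb : b < 2048) (h : vec a = vec b) : a = b := by
  refine Nat.eq_of_testBit_eq fun i => ?_
  by_cases hi : i < 11
  · have := congrFun h ⟨i, hi⟩
    simp only [vec] at this
    revert this
    cases a.testBit i <;> cases b.testBit i <;> simp
  · have hp : 2 ^ 11 ≤ 2 ^ i := Nat.pow_le_pow_right (by norm_num) (by omega)
    rw [Nat.testBit_lt_two_pow (by omega), Nat.testBit_lt_two_pow (by omega)]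

theorem vex_inj {a b : ℕ} (h : vec (ex a) = vec (ex b)) : ex a = ex b :=
  vec_inj (ex_lt _) (ex_lt _) h

theorem vex_ne (a : ℕ) : vec (ex a) ≠ 0 := fun h =>
  ex_ne_zero a (vec_inj (ex_lt _) (by norm_num) (h.trans vec_zero.symm))

theorem vec_self (w : Fin 11 → ZMod 2) : w + w = 0 := by
  funext j
  exact CharTwo.add_self_eq_zero (w j)

theorem z2 (c : ZMod 2) : c = 0 ∨ c = 1 := by
  revert c; decide

/-- The `k`-th shift of the `i`-th plane. -/
def plane (i : Fin 39) (k : Fin 2047) : Submodule (ZMod 2) (Fin 11 → ZMod 2) where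
  carrier := {w | w = 0 ∨ ∃ p ∈ blk i, w = vec (ex (p.1 + k))}
  zero_mem' := Or.inl rfl
  add_mem' := by
    rintro a b (rfl | ⟨p, hp, rfl⟩) hb
    · rw [zero_add]; exact hb
    · rcases hb with rfl | ⟨q, hq, rfl⟩
      · rw [add_zero]; exact Or.inr ⟨p, hp, rfl⟩
      · rcases blk_closed i.2 hp hq k with h | ⟨r, hr, h⟩
        · left; rw [h, vec_self]
        · right; exact ⟨r, hr, by rw [← vec_xor, h]⟩
  smul_mem' := by
    intro c x hx
    rcases z2 c with rfl | rfl
    · left; rw [zero_smul]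
    · rw [one_smul]; exact hx

theorem mem_plane {i : Fin 39} {k : Fin 2047} {w : Fin 11 → ZMod 2} :
    w ∈ plane i k ↔ w = 0 ∨ ∃ p ∈ blk i, w = vec (ex (p.1 + k)) := Iff.rfl

theorem plane_key {i j : Fin 39} {k l : Fin 2047} {u w : Fin 11 → ZMod 2}
    (hu : u ≠ 0) (hw : w ≠ 0) (huw : u ≠ w) (h1 : u ∈ plane i k) (h2 : u ∈ plane j l)
    (h3 : w ∈ plane i k) (h4 : w ∈ plane j l) : i = j ∧ k = l := by
  obtain ⟨p, hp, rfl⟩ := (mem_plane.1 h1).resolve_left hu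
  obtain ⟨p', hp', e1⟩ := (mem_plane.1 h2).resolve_left hu
  obtain ⟨q, hq, rfl⟩ := (mem_plane.1 h3).resolve_left hw
  obtain ⟨q', hq', e2⟩ := (mem_plane.1 h4).resolve_left hw
  have := key i.2 j.2 k.2 l.2 hp hq hp' hq' (vex_inj e1) (vex_inj e2)
    (fun h => huw (by rw [h]))
  exact ⟨Fin.ext this.1, Fin.ext this.2⟩

theorem plane_card (i : Fin 39) (k : Fin 2047) : Nat.card (plane i k) = 8 := by
  classical
  obtain ⟨hn, hl⟩ := data_card _ (blk_mem i.2)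
  set A : Finset ℕ := ((blk i).map Prod.fst).toFinset with hA
  have hc : A.card = 7 := by
    rw [hA, List.toFinset_card_of_nodup hn, List.length_map, hl]
  have hinj : Set.InjOn (fun s => vec (ex (s + k))) (A : Set ℕ) := by
    intro s hs t ht h
    have := ex_inj _ _ (vex_inj h)
    simp only [hA, List.coe_toFinset, Set.mem_ofPred_eq, List.mem_map] at hs ht
    obtain ⟨p, hp, rfl⟩ := hs
    obtain ⟨q, hq, rfl⟩ := ht
    have b1 := (blk_val i.2 hp).1
    have b2 := (blk_val i.2 hq).1
    omega
  have hset : ((plane i k : Submodule (ZMod 2) (Fin 11 → ZMod 2)) : Set (Fin 11 → ZMod 2)) =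
      ((insert 0 (A.image fun s => vec (ex (s + k))) : Finset (Fin 11 → ZMod 2)) :
        Set (Fin 11 → ZMod 2)) := by
    ext w
    simp only [SetLike.mem_coe, mem_plane, Finset.coe_insert, Finset.coe_image,
      Set.mem_insert_iff, Set.mem_image, hA, List.coe_toFinset, Set.mem_ofPred_eq, List.mem_map]
    constructor
    · rintro (h | ⟨p, hp, rfl⟩)
      · exact Or.inl h
      · exact Or.inr ⟨p.1, ⟨p, hp, rfl⟩, rfl⟩
    · rintro (h | ⟨s, ⟨p, hp, rfl⟩, rfl⟩)
      · exact Or.inl h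
      · exact Or.inr ⟨p, hp, rfl⟩
  have h0 : (0 : Fin 11 → ZMod 2) ∉ A.image fun s => vec (ex (s + k)) := by
    intro h
    obtain ⟨s, -, hs⟩ := Finset.mem_image.1 h
    exact vex_ne _ hs
  change Nat.card ((plane i k : Submodule (ZMod 2) (Fin 11 → ZMod 2)) : Set (Fin 11 → ZMod 2)) = 8
  rw [Nat.card_coe_set_eq, hset, Set.ncard_coe_finset, Finset.card_insert_of_notMem h0,
    Finset.card_image_of_injOn hinj, hc]

theorem plane_finrank (i : Fin 39) (k : Fin 2047) : finrank (ZMod 2) (plane i k) = 3 := by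
  have h := Module.natCard_eq_pow_finrank (K := ZMod 2) (V := plane i k)
  rw [plane_card, Nat.card_zmod] at h
  exact (Nat.pow_right_injective (le_refl 2) (h.symm.trans (by norm_num : 8 = 2 ^ 3)))

theorem inf_le {i j : Fin 39} {k l : Fin 2047} (h : ¬ (i = j ∧ k = l)) :
    finrank (ZMod 2) ↥(plane i k ⊓ plane j l) ≤ 1 := by
  by_cases hx : ∃ u ∈ plane i k ⊓ plane j l, u ≠ 0
  · obtain ⟨u, hu, hu0⟩ := hx
    refine finrank_le_one (⟨u, hu⟩ : ↥(plane i k ⊓ plane j l)) ?_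
    rintro ⟨w, hw⟩
    by_cases hw0 : w = 0
    · exact ⟨0, Subtype.ext (by simp [hw0])⟩
    · by_cases huw : u = w
      · exact ⟨1, Subtype.ext (by simp [huw])⟩
      · exact absurd (plane_key hu0 hw0 huw hu.1 hu.2 hw.1 hw.2) h
  · push Not at hx
    refine finrank_le_one (0 : ↥(plane i k ⊓ plane j l)) ?_
    rintro ⟨w, hw⟩
    exact ⟨0, Subtype.ext (by simp [hx w hw])⟩

theorem plane_inj : Function.Injective fun x : Fin 39 × Fin 2047 => plane x.1 x.2 := by
  rintro ⟨i, k⟩ ⟨j, l⟩ h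
  by_contra hne
  have h1 : ¬ (i = j ∧ k = l) := fun h => hne (by rw [h.1, h.2])
  have h2 := inf_le h1
  dsimp only at h
  rw [← h, inf_idem, plane_finrank] at h2
  omega

end SingerCode

/-- There exist 79833$ three-dimensional subspaces of `GF(2)^11` such
that any two distinct ones intersect in a subspace of dimension at most 1;
equivalently, a constant dimension code in `GF(2)^11` of dimension 3 with 79833
codewords and minimum subspace distance at least 4, so `A_2(11,4,3) ≥ 79833`. -/
theorem exists_code_GF2_11_dim3_card_79833 :
    ∃ C : Set (Submodule (ZMod 2) (Fin 11 → ZMod 2)),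
      C.ncard = 79833 ∧
      (∀ V ∈ C, finrank (ZMod 2) ↥V = 3) ∧
      (∀ V ∈ C, ∀ W ∈ C, V ≠ W → finrank (ZMod 2) ↥(V ⊓ W) ≤ 1) ∧
      (∀ V ∈ C, ∀ W ∈ C, V ≠ W → 4 ≤ subspaceDist (ZMod 2) V W) := by
  have hinf : ∀ V ∈ Set.range (fun x : Fin 39 × Fin 2047 => SingerCode.plane x.1 x.2),
      ∀ W ∈ Set.range (fun x : Fin 39 × Fin 2047 => SingerCode.plane x.1 x.2), V ≠ W →
      finrank (ZMod 2) ↥(V ⊓ W) ≤ 1 := by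
    rintro _ ⟨⟨i, k⟩, rfl⟩ _ ⟨⟨j, l⟩, rfl⟩ h
    exact SingerCode.inf_le fun e => h (by rw [Prod.ext e.1 e.2])
  refine ⟨Set.range fun x : Fin 39 × Fin 2047 => SingerCode.plane x.1 x.2, ?_, ?_, hinf, ?_⟩
  · rw [← Nat.card_coe_set_eq, Nat.card_range_of_injective SingerCode.plane_inj]
    simp
  · rintro _ ⟨⟨i, k⟩, rfl⟩
    exact SingerCode.plane_finrank i k
  · intro V hV W hW h
    have h1 := hinf V hV W hW h
    have h2 := Submodule.finrank_sup_add_finrank_inf_eq V W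
    obtain ⟨⟨i, k⟩, rfl⟩ := hV
    obtain ⟨⟨j, l⟩, rfl⟩ := hW
    have h3 := SingerCode.plane_finrank i k
    have h4 := SingerCode.plane_finrank j l
    unfold subspaceDist
    dsimp only at h1 h2 ⊢
    omega
end
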